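/- Let f : ℝ² × [0,∞) → ℝ be a smooth function satisfying the graphical mean curvature flow equation f_t = (f_xx(1 + f_y²) − 2 f_x f_y f_xy + f_yy(1 + f_x²)) / (1 + f_x² + f_y²) on a neighborhood of the origin, with f(0,0,0) = 0, f_x(0,0,0) = 0 and f_y(0,0,0) = 0. Then, as t → 0⁺, f(0,0,t) = t [f_xx + f_yy] + t² [ (1/2)(f_xxxx + 2 f_xxyy + f_yyyy) − (f_xx³ + 3 f_xx f_xy² + 3 f_yy f_xy² + f_yy³) ] + O(t³), where all derivatives on the right-hand side are evaluated at (0,0,0). -/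

import Mathlib

/-- Partial derivative in the first variable of a function of two real variables. -/
noncomputable def pdx (g : ℝ → ℝ → ℝ) (x y : ℝ) : ℝ := deriv (fun s => g s y) x

/-- Partial derivative in the second variable of a function of two real variables. -/
noncomputable def pdy (g : ℝ → ℝ → ℝ) (x y : ℝ) : ℝ := deriv (fun s => g x s) y

open Set Filter Topology

/-- Partial derivatives of a function of three real variables. -/
noncomputable def P1 (f : ℝ → ℝ → ℝ → ℝ) (x y t : ℝ) : ℝ := deriv (fun s => f s y t) x
noncomputable def P2 (f : ℝ → ℝ → ℝ → ℝ) (x y t : ℝ) : ℝ := deriv (fun s => f x s t) y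
noncomputable def P3 (f : ℝ → ℝ → ℝ → ℝ) (x y t : ℝ) : ℝ := deriv (fun s => f x y s) t

/-- Joint smoothness. -/
def Sm (f : ℝ → ℝ → ℝ → ℝ) : Prop :=
  ContDiff ℝ (⊤ : ℕ∞) (fun p : ℝ × ℝ × ℝ => f p.1 p.2.1 p.2.2)

/-- Uncurrying. -/
def Un (f : ℝ → ℝ → ℝ → ℝ) : ℝ × ℝ × ℝ → ℝ := fun p => f p.1 p.2.1 p.2.2

lemma Sm.diff {f} (h : Sm f) : Differentiable ℝ (Un f) :=
  ContDiff.differentiable h (by simp)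

lemma P1_eq {f} (h : Sm f) (x y t : ℝ) : P1 f x y t = fderiv ℝ (Un f) (x, y, t) (1, 0, 0) := by
  have h1 : HasDerivAt (fun s : ℝ => (s, y, t)) ((1 : ℝ), (0 : ℝ), (0 : ℝ)) x :=
    (hasDerivAt_id x).prodMk ((hasDerivAt_const x y).prodMk (hasDerivAt_const x t))
  exact (HasFDerivAt.comp_hasDerivAt x (h.diff (x, y, t)).hasFDerivAt h1).deriv

lemma P2_eq {f} (h : Sm f) (x y t : ℝ) : P2 f x y t = fderiv ℝ (Un f) (x, y, t) (0, 1, 0) := by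
  have h1 : HasDerivAt (fun s : ℝ => (x, s, t)) ((0 : ℝ), (1 : ℝ), (0 : ℝ)) y :=
    (hasDerivAt_const y x).prodMk ((hasDerivAt_id y).prodMk (hasDerivAt_const y t))
  exact (HasFDerivAt.comp_hasDerivAt y (h.diff (x, y, t)).hasFDerivAt h1).deriv

lemma P3_eq {f} (h : Sm f) (x y t : ℝ) : P3 f x y t = fderiv ℝ (Un f) (x, y, t) (0, 0, 1) := by
  have h1 : HasDerivAt (fun s : ℝ => (x, y, s)) ((0 : ℝ), (0 : ℝ), (1 : ℝ)) t :=
    (hasDerivAt_const t x).prodMk ((hasDerivAt_const t y).prodMk (hasDerivAt_id t))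
  exact (HasFDerivAt.comp_hasDerivAt t (h.diff (x, y, t)).hasFDerivAt h1).deriv

lemma Un_P1 {f} (h : Sm f) : Un (P1 f) = fun p => fderiv ℝ (Un f) p (1, 0, 0) :=
  funext fun p => P1_eq h p.1 p.2.1 p.2.2
lemma Un_P2 {f} (h : Sm f) : Un (P2 f) = fun p => fderiv ℝ (Un f) p (0, 1, 0) :=
  funext fun p => P2_eq h p.1 p.2.1 p.2.2
lemma Un_P3 {f} (h : Sm f) : Un (P3 f) = fun p => fderiv ℝ (Un f) p (0, 0, 1) :=
  funext fun p => P3_eq h p.1 p.2.1 p.2.2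

lemma Sm.fderiv_smooth {f} (h : Sm f) : ContDiff ℝ (⊤ : ℕ∞) (fderiv ℝ (Un f)) :=
  ContDiff.fderiv_right (m := ((⊤ : ℕ∞) : WithTop ℕ∞)) h (by simp)

lemma Sm.dir {f} (h : Sm f) (v : ℝ × ℝ × ℝ) :
    ContDiff ℝ (⊤ : ℕ∞) (fun p => fderiv ℝ (Un f) p v) :=
  h.fderiv_smooth.clm_apply contDiff_const

lemma Sm.p1 {f} (h : Sm f) : Sm (P1 f) := by
  change ContDiff ℝ _ (Un (P1 f)); rw [Un_P1 h]; exact h.dir _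
lemma Sm.p2 {f} (h : Sm f) : Sm (P2 f) := by
  change ContDiff ℝ _ (Un (P2 f)); rw [Un_P2 h]; exact h.dir _
lemma Sm.p3 {f} (h : Sm f) : Sm (P3 f) := by
  change ContDiff ℝ _ (Un (P3 f)); rw [Un_P3 h]; exact h.dir _

lemma dir_comm {f} (h : Sm f) (p v w : ℝ × ℝ × ℝ) :
    fderiv ℝ (fun q => fderiv ℝ (Un f) q v) p w = fderiv ℝ (fun q => fderiv ℝ (Un f) q w) p v := by
  have hd : DifferentiableAt ℝ (fderiv ℝ (Un f)) p :=
    (h.fderiv_smooth.differentiable (by simp)) p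
  have key : ∀ a b : ℝ × ℝ × ℝ, fderiv ℝ (fun q => fderiv ℝ (Un f) q a) p b
      = fderiv ℝ (fderiv ℝ (Un f)) p b a := by
    intro a b
    rw [fderiv_clm_apply hd (differentiableAt_const a)]
    simp
  rw [key, key]
  have hs : IsSymmSndFDerivAt ℝ (Un f) p :=
    ContDiffAt.isSymmSndFDerivAt (n := ((⊤ : ℕ∞) : WithTop ℕ∞)) (ContDiff.contDiffAt h)
      (by simp only [minSmoothness_of_isRCLikeNormedField]; exact WithTop.coe_le_coe.2 le_top)
  exact hs w v

lemma P12 {f} (h : Sm f) : P1 (P2 f) = P2 (P1 f) := by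
  funext x y t
  rw [P1_eq h.p2, P2_eq h.p1, Un_P1 h, Un_P2 h, dir_comm h]
lemma P13 {f} (h : Sm f) : P1 (P3 f) = P3 (P1 f) := by
  funext x y t
  rw [P1_eq h.p3, P3_eq h.p1, Un_P1 h, Un_P3 h, dir_comm h]
lemma P23 {f} (h : Sm f) : P2 (P3 f) = P3 (P2 f) := by
  funext x y t
  rw [P2_eq h.p3, P3_eq h.p2, Un_P2 h, Un_P3 h, dir_comm h]

lemma Sm.s1 {f} (h : Sm f) (y t : ℝ) : ContDiff ℝ (⊤ : ℕ∞) (fun s => f s y t) :=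
  ContDiff.comp (g := Un f) h (f := fun s => (s, y, t)) (by fun_prop)
lemma Sm.s2 {f} (h : Sm f) (x t : ℝ) : ContDiff ℝ (⊤ : ℕ∞) (fun s => f x s t) :=
  ContDiff.comp (g := Un f) h (f := fun s => (x, s, t)) (by fun_prop)
lemma Sm.s3 {f} (h : Sm f) (x y : ℝ) : ContDiff ℝ (⊤ : ℕ∞) (fun s => f x y s) :=
  ContDiff.comp (g := Un f) h (f := fun s => (x, y, s)) (by fun_prop)

lemma cd_hd {u : ℝ → ℝ} (h : ContDiff ℝ (⊤ : ℕ∞) u) (x : ℝ) : HasDerivAt u (deriv u x) x :=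
  ((h.differentiable (by simp)) x).hasDerivAt

lemma cd_deriv {u : ℝ → ℝ} (h : ContDiff ℝ (⊤ : ℕ∞) u) : ContDiff ℝ (⊤ : ℕ∞) (deriv u) := by
  have h' : ContDiff ℝ (((⊤ : ℕ∞) : WithTop ℕ∞) + 1) u := by simpa using h
  exact (contDiff_succ_iff_deriv.1 h').2.2

lemma triple_deriv {a u v : ℝ → ℝ} (ha : ContDiff ℝ (⊤ : ℕ∞) a) (hu : ContDiff ℝ (⊤ : ℕ∞) u)
    (hv : ContDiff ℝ (⊤ : ℕ∞) v) : deriv (fun x => a x * u x * v x) =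
      fun x => (deriv a x * u x + a x * deriv u x) * v x + a x * u x * deriv v x := by
  funext x
  exact (((cd_hd ha x).mul (cd_hd hu x)).mul (cd_hd hv x)).deriv

lemma triple1 {a u v : ℝ → ℝ} (ha : ContDiff ℝ (⊤ : ℕ∞) a) (hu : ContDiff ℝ (⊤ : ℕ∞) u)
    (hv : ContDiff ℝ (⊤ : ℕ∞) v) (u0 : u 0 = 0) (v0 : v 0 = 0) :
    deriv (fun x => a x * u x * v x) 0 = 0 := by
  rw [triple_deriv ha hu hv]; simp [u0, v0]

lemma triple2 {a u v : ℝ → ℝ} (ha : ContDiff ℝ (⊤ : ℕ∞) a) (hu : ContDiff ℝ (⊤ : ℕ∞) u)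
    (hv : ContDiff ℝ (⊤ : ℕ∞) v) (u0 : u 0 = 0) (v0 : v 0 = 0) :
    deriv (deriv (fun x => a x * u x * v x)) 0 = 2 * a 0 * deriv u 0 * deriv v 0 := by
  rw [triple_deriv ha hu hv]
  have da := cd_hd ha 0
  have du := cd_hd hu 0
  have dv := cd_hd hv 0
  have dda := cd_hd (cd_deriv ha) 0
  have ddu := cd_hd (cd_deriv hu) 0
  have ddv := cd_hd (cd_deriv hv) 0
  have := ((((dda.mul du).add (da.mul ddu)).mul dv).add ((da.mul du).mul ddv)).deriv
  refine Eq.trans this ?_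
  simp [u0, v0]
  ring

/-- One-variable restriction of the right-hand side of the flow. -/
noncomputable def rhs (a b c u v : ℝ → ℝ) (x : ℝ) : ℝ :=
  (a x * (1 + v x ^ 2) - 2 * u x * v x * b x + c x * (1 + u x ^ 2)) / (1 + u x ^ 2 + v x ^ 2)

section
variable {a b c u v : ℝ → ℝ}

lemma rhs_eq : rhs a b c u v = fun x => a x + c x -
    ((a x / (1 + u x ^ 2 + v x ^ 2)) * u x * u x + (2 * b x / (1 + u x ^ 2 + v x ^ 2)) * u x * v x
      + (c x / (1 + u x ^ 2 + v x ^ 2)) * v x * v x) := by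
  funext x
  have : 1 + u x ^ 2 + v x ^ 2 ≠ 0 := by positivity
  unfold rhs
  field_simp
  ring

lemma cd_div (ha : ContDiff ℝ (⊤ : ℕ∞) a) (hu : ContDiff ℝ (⊤ : ℕ∞) u)
    (hv : ContDiff ℝ (⊤ : ℕ∞) v) :
    ContDiff ℝ (⊤ : ℕ∞) (fun x => a x / (1 + u x ^ 2 + v x ^ 2)) := by
  apply ContDiff.div ha (by fun_prop)
  intro x
  positivity

lemma comb_deriv {k p q r : ℝ → ℝ} {l : ℝ → ℝ} (hk : ContDiff ℝ (⊤ : ℕ∞) k)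
    (hl : ContDiff ℝ (⊤ : ℕ∞) l) (hp : ContDiff ℝ (⊤ : ℕ∞) p)
    (hq : ContDiff ℝ (⊤ : ℕ∞) q) (hr : ContDiff ℝ (⊤ : ℕ∞) r) :
    deriv (fun x => k x + l x - (p x + q x + r x)) =
      fun x => deriv k x + deriv l x - (deriv p x + deriv q x + deriv r x) := by
  funext x
  exact (((cd_hd hk x).add (cd_hd hl x)).sub
    (((cd_hd hp x).add (cd_hd hq x)).add (cd_hd hr x))).deriv

lemma rhs_derivs (ha : ContDiff ℝ (⊤ : ℕ∞) a) (hb : ContDiff ℝ (⊤ : ℕ∞) b)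
    (hc : ContDiff ℝ (⊤ : ℕ∞) c) (hu : ContDiff ℝ (⊤ : ℕ∞) u)
    (hv : ContDiff ℝ (⊤ : ℕ∞) v) (u0 : u 0 = 0) (v0 : v 0 = 0) :
    Differentiable ℝ (rhs a b c u v) ∧
    deriv (rhs a b c u v) 0 = deriv a 0 + deriv c 0 ∧
    deriv (deriv (rhs a b c u v)) 0 = deriv (deriv a) 0 + deriv (deriv c) 0
      - 2 * (a 0 * deriv u 0 ^ 2 + 2 * b 0 * deriv u 0 * deriv v 0 + c 0 * deriv v 0 ^ 2) := by
  have hA := cd_div ha hu hv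
  have hB := cd_div (a := fun x => 2 * b x) (by fun_prop) hu hv
  have hC := cd_div hc hu hv
  have h1 := (hA.mul hu).mul hu
  have h2 := (hB.mul hu).mul hv
  have h3 := (hC.mul hv).mul hv
  rw [rhs_eq]
  refine ⟨?_, ?_, ?_⟩
  · exact ((ha.add hc).sub ((h1.add h2).add h3)).differentiable (by simp)
  · rw [comb_deriv ha hc h1 h2 h3]
    simp only
    rw [triple1 hA hu hu u0 u0, triple1 hB hu hv u0 v0, triple1 hC hv hv v0 v0]
    ring
  · rw [comb_deriv ha hc h1 h2 h3, comb_deriv (cd_deriv ha) (cd_deriv hc) (cd_deriv h1)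
      (cd_deriv h2) (cd_deriv h3)]
    simp only
    rw [triple2 hA hu hu u0 u0, triple2 hB hu hv u0 v0, triple2 hC hv hv v0 v0]
    simp only [u0, v0]
    ring
end

lemma taylor_bound {h : ℝ → ℝ} (hh : ContDiff ℝ (⊤ : ℕ∞) h) :
    ∃ C : ℝ, ∀ t : ℝ, 0 < t → t < 1 →
      |h t - (h 0 + t * deriv h 0 + t ^ 2 * ((1 / 2) * deriv (deriv h) 0))| ≤ C * t ^ 3 := by
  obtain ⟨C, hC⟩ := exists_taylor_mean_remainder_bound (f := h) (a := 0) (b := 1) (n := 2)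
    zero_le_one ((hh.of_le (WithTop.coe_le_coe.2 le_top)).contDiffOn)
  refine ⟨C, fun t h0 h1 => ?_⟩
  have := hC t ⟨h0.le, h1.le⟩
  have e : ∀ n : ℕ, iteratedDerivWithin n h (Icc 0 1) 0 = iteratedDeriv n h 0 := fun n =>
    iteratedDerivWithin_eq_iteratedDeriv (uniqueDiffOn_Icc zero_lt_one)
      ((hh.of_le (by exact_mod_cast le_top)).contDiffAt) (by simp)
  simp only [taylor_within_zero_eval, taylorWithinEval_succ, e, iteratedDeriv_succ,
    iteratedDeriv_zero] at this
  norm_num at this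
  convert this using 2
  ring

/-- Short-time expansion of graphical mean curvature flow in `ℝ³`:
`f(0,0,t) = t (f_xx + f_yy) + t² ((1/2)(f_xxxx + 2 f_xxyy + f_yyyy)
  − (f_xx³ + 3 f_xx f_xy² + 3 f_yy f_xy² + f_yy³)) + O(t³)` as `t → 0⁺`. -/
theorem mcf_graph_expansion_3d (f : ℝ → ℝ → ℝ → ℝ)
    (hf : ContDiff ℝ (⊤ : ℕ∞) (fun p : ℝ × ℝ × ℝ => f p.1 p.2.1 p.2.2))
    (h0 : f 0 0 0 = 0)
    (hfx : pdx (fun x y => f x y 0) 0 0 = 0)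
    (hfy : pdy (fun x y => f x y 0) 0 0 = 0)
    (hpde : ∃ δ : ℝ, 0 < δ ∧ ∀ x y t : ℝ, |x| < δ → |y| < δ → 0 ≤ t → t < δ →
      deriv (fun s => f x y s) t =
        (pdx (pdx (fun a b => f a b t)) x y * (1 + (pdy (fun a b => f a b t) x y) ^ 2)
          - 2 * pdx (fun a b => f a b t) x y * pdy (fun a b => f a b t) x y *
              pdx (fun a b => pdy (fun c d => f c d t) a b) x y
          + pdy (pdy (fun a b => f a b t)) x y * (1 + (pdx (fun a b => f a b t) x y) ^ 2))
        / (1 + (pdx (fun a b => f a b t) x y) ^ 2 + (pdy (fun a b => f a b t) x y) ^ 2)) :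
    let g : ℝ → ℝ → ℝ := fun x y => f x y 0
    let fxx := pdx (pdx g) 0 0
    let fyy := pdy (pdy g) 0 0
    let fxy := pdx (fun a b => pdy g a b) 0 0
    let fxxxx := pdx (pdx (pdx (pdx g))) 0 0
    let fxxyy := pdx (pdx (pdy (pdy g))) 0 0
    let fyyyy := pdy (pdy (pdy (pdy g))) 0 0
    ∃ C ε : ℝ, 0 < ε ∧ ∀ t : ℝ, 0 < t → t < ε →
      |f 0 0 t - (t * (fxx + fyy)
        + t ^ 2 * ((1 / 2) * (fxxxx + 2 * fxxyy + fyyyy)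
          - (fxx ^ 3 + 3 * fxx * fxy ^ 2 + 3 * fyy * fxy ^ 2 + fyy ^ 3)))| ≤ C * t ^ 3 := by
  have hS : Sm f := hf
  obtain ⟨δ, hδ, H⟩ := hpde
  have H' : ∀ x y t : ℝ, |x| < δ → |y| < δ → 0 ≤ t → t < δ → P3 f x y t =
      (P1 (P1 f) x y t * (1 + P2 f x y t ^ 2) - 2 * P1 f x y t * P2 f x y t * P1 (P2 f) x y t
        + P2 (P2 f) x y t * (1 + P1 f x y t ^ 2)) / (1 + P1 f x y t ^ 2 + P2 f x y t ^ 2) := H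
  clear H
  have u0 : P1 f 0 0 0 = 0 := hfx
  have v0 : P2 f 0 0 0 = 0 := hfy
  have near : ∀ᶠ x in 𝓝 (0 : ℝ), |x| < δ := by
    filter_upwards [Metric.ball_mem_nhds (0 : ℝ) hδ] with x hx
    simpa [Real.dist_eq] using hx
  have d0 : |(0 : ℝ)| < δ := by simpa using hδ
  obtain ⟨-, -, r1⟩ := rhs_derivs (hS.p1.p1.s1 0 0) (hS.p2.p1.s1 0 0) (hS.p2.p2.s1 0 0)
    (hS.p1.s1 0 0) (hS.p2.s1 0 0) u0 v0
  obtain ⟨-, -, r2⟩ := rhs_derivs (hS.p1.p1.s2 0 0) (hS.p2.p1.s2 0 0) (hS.p2.p2.s2 0 0)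
    (hS.p1.s2 0 0) (hS.p2.s2 0 0) u0 v0
  obtain ⟨r3d, r3, -⟩ := rhs_derivs (hS.p1.p1.s3 0 0) (hS.p2.p1.s3 0 0) (hS.p2.p2.s3 0 0)
    (hS.p1.s3 0 0) (hS.p2.s3 0 0) u0 v0
  have e1 : (fun s => P3 f s 0 0) =ᶠ[𝓝 0] rhs (fun s => P1 (P1 f) s 0 0)
      (fun s => P1 (P2 f) s 0 0) (fun s => P2 (P2 f) s 0 0) (fun s => P1 f s 0 0)
      (fun s => P2 f s 0 0) := by
    filter_upwards [near] with x hx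
    exact H' x 0 0 hx d0 le_rfl hδ
  have e2 : (fun s => P3 f 0 s 0) =ᶠ[𝓝 0] rhs (fun s => P1 (P1 f) 0 s 0)
      (fun s => P1 (P2 f) 0 s 0) (fun s => P2 (P2 f) 0 s 0) (fun s => P1 f 0 s 0)
      (fun s => P2 f 0 s 0) := by
    filter_upwards [near] with x hx
    exact H' 0 x 0 d0 hx le_rfl hδ
  have q1 := e1.deriv.deriv_eq.trans r1
  have q2 := e2.deriv.deriv_eq.trans r2
  have q3 : deriv (fun s => P3 f 0 0 s) 0 = P3 (P1 (P1 f)) 0 0 0 + P3 (P2 (P2 f)) 0 0 0 := by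
    refine Eq.trans ?_ r3
    have hu : UniqueDiffWithinAt ℝ (Ico 0 δ) (0 : ℝ) :=
      (uniqueDiffOn_Ico 0 δ) 0 ⟨le_rfl, hδ⟩
    have w1 := (cd_hd (hS.p3.s3 0 0) 0).hasDerivWithinAt (s := Ico 0 δ)
    have w2 := (r3d 0).hasDerivAt.hasDerivWithinAt (s := Ico 0 δ)
    have w3 := w2.congr (f₁ := fun s => P3 f 0 0 s) (fun t ht => H' 0 0 t d0 d0 ht.1 ht.2)
      (H' 0 0 0 d0 d0 le_rfl hδ)
    exact hu.eq_deriv _ w1 w3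
  have q1' : P1 (P1 (P3 f)) 0 0 0 = P1 (P1 (P1 (P1 f))) 0 0 0 + P1 (P1 (P2 (P2 f))) 0 0 0
      - 2 * (P1 (P1 f) 0 0 0 * P1 (P1 f) 0 0 0 ^ 2
        + 2 * P1 (P2 f) 0 0 0 * P1 (P1 f) 0 0 0 * P1 (P2 f) 0 0 0
        + P2 (P2 f) 0 0 0 * P1 (P2 f) 0 0 0 ^ 2) := q1
  have q2' : P2 (P2 (P3 f)) 0 0 0 = P2 (P2 (P1 (P1 f))) 0 0 0 + P2 (P2 (P2 (P2 f))) 0 0 0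
      - 2 * (P1 (P1 f) 0 0 0 * P2 (P1 f) 0 0 0 ^ 2
        + 2 * P1 (P2 f) 0 0 0 * P2 (P1 f) 0 0 0 * P2 (P2 f) 0 0 0
        + P2 (P2 f) 0 0 0 * P2 (P2 f) 0 0 0 ^ 2) := q2
  have c1 : P3 (P1 (P1 f)) = P1 (P1 (P3 f)) := by rw [P13 hS, P13 hS.p1]
  have c2 : P3 (P2 (P2 f)) = P2 (P2 (P3 f)) := by rw [P23 hS, P23 hS.p2]
  have c3 : P2 (P2 (P1 (P1 f))) = P1 (P1 (P2 (P2 f))) := by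
    rw [P12 hS.p2, P12 hS, P12 hS.p1.p2, P12 hS.p1]
  rw [c3, ← P12 hS] at q2'
  rw [c1, c2, q1', q2'] at q3
  have t1 : P3 f 0 0 0 = P1 (P1 f) 0 0 0 + P2 (P2 f) 0 0 0 := by
    rw [H' 0 0 0 d0 d0 le_rfl hδ, u0, v0]; simp
  obtain ⟨C, hC⟩ := taylor_bound (hS.s3 0 0)
  intro g fxx fyy fxy fxxxx fxxyy fyyyy
  refine ⟨C, 1, one_pos, fun t ht ht1 => ?_⟩
  have hb := hC t ht ht1
  have t1' : deriv (fun s => f 0 0 s) 0 = fxx + fyy := t1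
  have t2' : deriv (deriv (fun s => f 0 0 s)) 0 = fxxxx + fxxyy
      - 2 * (fxx * fxx ^ 2 + 2 * fxy * fxx * fxy + fyy * fxy ^ 2) + (fxxyy + fyyyy
      - 2 * (fxx * fxy ^ 2 + 2 * fxy * fxy * fyy + fyy * fyy ^ 2)) := q3
  rw [t1', t2', h0] at hb
  refine le_trans (le_of_eq ?_) hb
  congr 1
  ring
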